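/- arXiv:1807.08661 — 2 statements merged into one kernel-verified Lean document; each statement's English description precedes it below -/
import Mathlib

section
/- For each fixed real b > 1 there exist constants C > 0 and δ ∈ (0,1) such that for all a ∈ (1-δ,1): (1/C)·(1-a)^{3/4} ≤ P₁(a,b) ≤ C·(1-a)^{3/4}, (1/C)·(1-a)^{1/4} ≤ P₂(a,b) ≤ C·(1-a)^{1/4}, 1/C ≤ Q₁(a,b) ≤ C, and 1/C ≤ Q₂(a,b) ≤ C. (Asymptotic orders of the SS-4 period integrals as a → 1⁻.) -/
open MeasureTheory Set

/-- P₁(a,b) = ∫_a^1 z^{-3/4}(z-a)^{1/2}(1-z)^{-3/4}(b-z)^{-1/4} dz -/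
noncomputable def P1 (a b : ℝ) : ℝ :=
  ∫ z in Ioo a 1, z ^ (-(3:ℝ)/4) * (z - a) ^ ((1:ℝ)/2) * (1 - z) ^ (-(3:ℝ)/4) * (b - z) ^ (-(1:ℝ)/4)

/-- Q₁(a,b) = ∫_0^a z^{-3/4}(a-z)^{1/2}(1-z)^{-3/4}(b-z)^{-1/4} dz -/
noncomputable def Q1 (a b : ℝ) : ℝ :=
  ∫ z in Ioo 0 a, z ^ (-(3:ℝ)/4) * (a - z) ^ ((1:ℝ)/2) * (1 - z) ^ (-(3:ℝ)/4) * (b - z) ^ (-(1:ℝ)/4)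

/-- P₂(a,b) = ∫_a^1 z^{-1/4}(z-a)^{-1/2}(1-z)^{-1/4}(b-z)^{-3/4} dz -/
noncomputable def P2 (a b : ℝ) : ℝ :=
  ∫ z in Ioo a 1, z ^ (-(1:ℝ)/4) * (z - a) ^ (-(1:ℝ)/2) * (1 - z) ^ (-(1:ℝ)/4) * (b - z) ^ (-(3:ℝ)/4)

/-- Q₂(a,b) = ∫_0^a z^{-1/4}(a-z)^{-1/2}(1-z)^{-1/4}(b-z)^{-3/4} dz -/
noncomputable def Q2 (a b : ℝ) : ℝ :=
  ∫ z in Ioo 0 a, z ^ (-(1:ℝ)/4) * (a - z) ^ (-(1:ℝ)/2) * (1 - z) ^ (-(1:ℝ)/4) * (b - z) ^ (-(3:ℝ)/4)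

open ProbabilityTheory

lemma integrable_betaPDFReal {α β : ℝ} (hα : 0 < α) (hβ : 0 < β) :
    Integrable (betaPDFReal α β) := by
  refine (lintegral_ofReal_ne_top_iff_integrable
    (stronglyMeasurable_betaPDFReal α β).aestronglyMeasurable
    (Filter.Eventually.of_forall fun x => ?_)).1 ?_
  · by_cases hx : 0 < x ∧ x < 1
    · exact (betaPDFReal_pos hx.1 hx.2 hα hβ).le
    · simp [betaPDFReal, hx]
  · have h := lintegral_betaPDF_eq_one hα hβ
    simp only [betaPDF] at h
    rw [h]
    exact ENNReal.one_ne_top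

lemma integral_betaPDFReal_eq_one {α β : ℝ} (hα : 0 < α) (hβ : 0 < β) :
    ∫ x, betaPDFReal α β x = 1 := by
  rw [integral_eq_lintegral_of_nonneg_ae (Filter.Eventually.of_forall fun x => ?_)
    (stronglyMeasurable_betaPDFReal α β).aestronglyMeasurable]
  · have h := lintegral_betaPDF_eq_one hα hβ
    simp only [betaPDF] at h
    rw [h, ENNReal.toReal_one]
  · by_cases hx : 0 < x ∧ x < 1
    · exact (betaPDFReal_pos hx.1 hx.2 hα hβ).le
    · simp [betaPDFReal, hx]

lemma indicator_beta_kernel_eq {α β u v : ℝ} (hα : 0 < α) (hβ : 0 < β) (huv : u < v) :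
    (Ioo u v).indicator (fun z : ℝ => (z - u) ^ (α - 1) * (v - z) ^ (β - 1)) =
      fun z => (beta α β * (v - u) ^ (α + β - 2)) * betaPDFReal α β ((z - u) / (v - u)) := by
  have hd : 0 < v - u := sub_pos.2 huv
  have hB := (beta_pos hα hβ).ne'
  funext z
  by_cases hz : z ∈ Ioo u v
  · have h₁ : 0 < z - u := sub_pos.2 hz.1
    have h₂ : 0 < v - z := sub_pos.2 hz.2
    have hlt : (z - u) / (v - u) < 1 := (div_lt_one hd).2 (by linarith)
    have hone : 1 - (z - u) / (v - u) = (v - z) / (v - u) := by field_simp; ring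
    rw [indicator_of_mem hz, betaPDFReal, if_pos ⟨div_pos h₁ hd, hlt⟩, hone,
      Real.div_rpow h₁.le hd.le, Real.div_rpow h₂.le hd.le,
      show α + β - 2 = (α - 1) + (β - 1) by ring, Real.rpow_add hd]
    have := (Real.rpow_pos_of_pos hd (α - 1)).ne'
    have := (Real.rpow_pos_of_pos hd (β - 1)).ne'
    field_simp
  · have : ¬ (0 < (z - u) / (v - u) ∧ (z - u) / (v - u) < 1) := fun h =>
      hz ⟨by linarith [(div_pos_iff_of_pos_right hd).1 h.1], by linarith [(div_lt_one hd).1 h.2]⟩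
    rw [indicator_of_notMem hz, betaPDFReal, if_neg this, mul_zero]

lemma integrableOn_beta_kernel {α β u v : ℝ} (hα : 0 < α) (hβ : 0 < β) (huv : u < v) :
    IntegrableOn (fun z : ℝ => (z - u) ^ (α - 1) * (v - z) ^ (β - 1)) (Ioo u v) := by
  rw [← integrable_indicator_iff measurableSet_Ioo, indicator_beta_kernel_eq hα hβ huv]
  exact (((integrable_betaPDFReal hα hβ).comp_div (sub_pos.2 huv).ne').comp_sub_right u).const_mul _

lemma integral_beta_kernel {α β u v : ℝ} (hα : 0 < α) (hβ : 0 < β) (huv : u < v) :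
    ∫ z in Ioo u v, (z - u) ^ (α - 1) * (v - z) ^ (β - 1) =
      beta α β * (v - u) ^ (α + β - 1) := by
  have hd : 0 < v - u := sub_pos.2 huv
  rw [← integral_indicator measurableSet_Ioo, indicator_beta_kernel_eq hα hβ huv,
    integral_const_mul, integral_sub_right_eq_self (fun z => betaPDFReal α β (z / (v - u))) u,
    Measure.integral_comp_div, integral_betaPDFReal_eq_one hα hβ, abs_of_pos hd,
    show α + β - 1 = (α + β - 2) + 1 by ring, Real.rpow_add hd, Real.rpow_one, smul_eq_mul]
  ring

lemma integrableOn_of_nonneg_of_le {f g : ℝ → ℝ} {s : Set ℝ} (hs : MeasurableSet s)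
    (hf : Measurable f) (hg : IntegrableOn g s) (h₀ : ∀ z ∈ s, 0 ≤ f z)
    (h : ∀ z ∈ s, f z ≤ g z) : IntegrableOn f s :=
  Integrable.mono' hg hf.aestronglyMeasurable <|
    (ae_restrict_iff' hs).2 <| Filter.Eventually.of_forall fun z hz => by
      rw [Real.norm_of_nonneg (h₀ z hz)]
      exact h z hz

lemma integral_bounds_of_beta_kernel {f : ℝ → ℝ} {α β u v c C : ℝ} (hα : 0 < α) (hβ : 0 < β)
    (huv : u < v) (hf : Measurable f) (hc : 0 ≤ c)
    (hl : ∀ z ∈ Ioo u v, c * ((z - u) ^ (α - 1) * (v - z) ^ (β - 1)) ≤ f z)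
    (hr : ∀ z ∈ Ioo u v, f z ≤ C * ((z - u) ^ (α - 1) * (v - z) ^ (β - 1))) :
    c * beta α β * (v - u) ^ (α + β - 1) ≤ ∫ z in Ioo u v, f z ∧
      ∫ z in Ioo u v, f z ≤ C * beta α β * (v - u) ^ (α + β - 1) := by
  have hk := integrableOn_beta_kernel hα hβ huv
  have h₀ : ∀ z ∈ Ioo u v, 0 ≤ f z := fun z hz => (mul_nonneg hc (mul_nonneg
    (Real.rpow_nonneg (sub_nonneg.2 hz.1.le) _) (Real.rpow_nonneg (sub_nonneg.2 hz.2.le) _))).trans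
    (hl z hz)
  have hfi := integrableOn_of_nonneg_of_le measurableSet_Ioo hf (hk.const_mul C) h₀ hr
  rw [mul_assoc, mul_assoc, ← integral_beta_kernel hα hβ huv, ← integral_const_mul,
    ← integral_const_mul]
  exact ⟨setIntegral_mono_on (hk.const_mul c) hfi measurableSet_Ioo hl,
    setIntegral_mono_on hfi (hk.const_mul C) measurableSet_Ioo hr⟩

/-- The integral of a nonnegative function over `(u, v)` dominates its infimum on a subinterval. -/
lemma const_mul_le_integral_Ioo {f : ℝ → ℝ} {u v w c : ℝ} (huw : u ≤ w) (hwv : w ≤ v)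
    (hfi : IntegrableOn f (Ioo u v)) (h₀ : ∀ z ∈ Ioo u v, 0 ≤ f z)
    (hl : ∀ z ∈ Ioo u w, c ≤ f z) : c * (w - u) ≤ ∫ z in Ioo u v, f z := by
  have hsub : Ioo u w ⊆ Ioo u v := Ioo_subset_Ioo_right hwv
  calc c * (w - u) = c * volume.real (Ioo u w) := by rw [Real.volume_real_Ioo_of_le huw]
    _ ≤ ∫ z in Ioo u w, f z :=
        setIntegral_ge_of_const_le_real measurableSet_Ioo (by simp) hl (hfi.mono_set hsub)
    _ ≤ ∫ z in Ioo u v, f z := setIntegral_mono_set hfi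
        ((ae_restrict_iff' measurableSet_Ioo).2 (Filter.Eventually.of_forall h₀))
        hsub.eventuallyLE

/-- Lower and upper bounds with positive constants yield a single two-sided constant. -/
lemma exists_two_sided_const {s : Set ℝ} {F X : ℝ → ℝ} {c C : ℝ} (hc : 0 < c)
    (hX : ∀ a ∈ s, 0 ≤ X a) (h : ∀ a ∈ s, c * X a ≤ F a ∧ F a ≤ C * X a) :
    ∃ K : ℝ, 0 < K ∧ ∀ D, K ≤ D → ∀ a ∈ s, 1 / D * X a ≤ F a ∧ F a ≤ D * X a := by
  refine ⟨max (1 / c) C, lt_max_of_lt_left (one_div_pos.2 hc), fun D hD a ha => ⟨?_, ?_⟩⟩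
  · refine (mul_le_mul_of_nonneg_right ?_ (hX a ha)).trans (h a ha).1
    exact (one_div_le hc ((lt_max_of_lt_left (one_div_pos.2 hc)).trans_le hD)).1
      ((le_max_left _ _).trans hD)
  · exact (h a ha).2.trans
      (mul_le_mul_of_nonneg_right ((le_max_right _ _).trans hD) (hX a ha))

lemma P1_bounds {b : ℝ} (hb : 1 < b) {a : ℝ} (ha : a ∈ Ioo (1 / 2 : ℝ) 1) :
    b ^ (-(1:ℝ)/4) * beta (3/2) (1/4) * (1 - a) ^ ((3:ℝ)/4) ≤ P1 a b ∧
      P1 a b ≤ (1/2 : ℝ) ^ (-(3:ℝ)/4) * (b - 1) ^ (-(1:ℝ)/4) * beta (3/2) (1/4) *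
        (1 - a) ^ ((3:ℝ)/4) := by
  have key := integral_bounds_of_beta_kernel (α := 3/2) (β := 1/4) (u := a) (v := 1)
    (f := fun z => z ^ (-(3:ℝ)/4) * (z - a) ^ ((1:ℝ)/2) * (1 - z) ^ (-(3:ℝ)/4) *
      (b - z) ^ (-(1:ℝ)/4))
    (c := b ^ (-(1:ℝ)/4)) (C := (1/2 : ℝ) ^ (-(3:ℝ)/4) * (b - 1) ^ (-(1:ℝ)/4))
    (by norm_num) (by norm_num) ha.2 (by fun_prop) (by positivity) ?_ ?_
  · rwa [show (3/2 + 1/4 - 1 : ℝ) = 3/4 by norm_num] at key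
  all_goals
    intro z hz
    obtain ⟨ha₁, ha₂⟩ := ha
    obtain ⟨hz₁, hz₂⟩ := hz
    rw [show (3/2 - 1 : ℝ) = 1/2 by norm_num, show (1/4 - 1 : ℝ) = -3/4 by norm_num]
    have e₁ : 0 ≤ (z - a) ^ ((1:ℝ)/2) := Real.rpow_nonneg (by linarith) _
    have e₂ : 0 ≤ (1 - z) ^ (-(3:ℝ)/4) := Real.rpow_nonneg (by linarith) _
    have hz₀ : 0 ≤ z ^ (-(3:ℝ)/4) := Real.rpow_nonneg (by linarith) _
    have hb₀ : 0 ≤ (b - z) ^ (-(1:ℝ)/4) := Real.rpow_nonneg (by linarith) _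
  · have h₁ : 1 ≤ z ^ (-(3:ℝ)/4) :=
      Real.one_le_rpow_of_pos_of_le_one_of_nonpos (by linarith) hz₂.le (by norm_num)
    have h₂ : b ^ (-(1:ℝ)/4) ≤ (b - z) ^ (-(1:ℝ)/4) :=
      Real.rpow_le_rpow_of_nonpos (by linarith) (by linarith) (by norm_num)
    have := mul_le_mul_of_nonneg_right (mul_le_mul h₁ h₂ (by positivity) hz₀) (mul_nonneg e₁ e₂)
    linarith
  · have h₁ : z ^ (-(3:ℝ)/4) ≤ (1/2) ^ (-(3:ℝ)/4) :=
      Real.rpow_le_rpow_of_nonpos (by linarith) (by linarith) (by norm_num)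
    have h₂ : (b - z) ^ (-(1:ℝ)/4) ≤ (b - 1) ^ (-(1:ℝ)/4) :=
      Real.rpow_le_rpow_of_nonpos (by linarith) (by linarith) (by norm_num)
    have := mul_le_mul_of_nonneg_right (mul_le_mul h₁ h₂ hb₀ (by positivity)) (mul_nonneg e₁ e₂)
    linarith

lemma P2_bounds {b : ℝ} (hb : 1 < b) {a : ℝ} (ha : a ∈ Ioo (1 / 2 : ℝ) 1) :
    b ^ (-(3:ℝ)/4) * beta (1/2) (3/4) * (1 - a) ^ ((1:ℝ)/4) ≤ P2 a b ∧
      P2 a b ≤ (1/2 : ℝ) ^ (-(1:ℝ)/4) * (b - 1) ^ (-(3:ℝ)/4) * beta (1/2) (3/4) *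
        (1 - a) ^ ((1:ℝ)/4) := by
  have key := integral_bounds_of_beta_kernel (α := 1/2) (β := 3/4) (u := a) (v := 1)
    (f := fun z => z ^ (-(1:ℝ)/4) * (z - a) ^ (-(1:ℝ)/2) * (1 - z) ^ (-(1:ℝ)/4) *
      (b - z) ^ (-(3:ℝ)/4))
    (c := b ^ (-(3:ℝ)/4)) (C := (1/2 : ℝ) ^ (-(1:ℝ)/4) * (b - 1) ^ (-(3:ℝ)/4))
    (by norm_num) (by norm_num) ha.2 (by fun_prop) (by positivity) ?_ ?_
  · rwa [show (1/2 + 3/4 - 1 : ℝ) = 1/4 by norm_num] at key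
  all_goals
    intro z hz
    obtain ⟨ha₁, ha₂⟩ := ha
    obtain ⟨hz₁, hz₂⟩ := hz
    rw [show (1/2 - 1 : ℝ) = -1/2 by norm_num, show (3/4 - 1 : ℝ) = -1/4 by norm_num]
    have e₁ : 0 ≤ (z - a) ^ (-(1:ℝ)/2) := Real.rpow_nonneg (by linarith) _
    have e₂ : 0 ≤ (1 - z) ^ (-(1:ℝ)/4) := Real.rpow_nonneg (by linarith) _
    have hz₀ : 0 ≤ z ^ (-(1:ℝ)/4) := Real.rpow_nonneg (by linarith) _
    have hb₀ : 0 ≤ (b - z) ^ (-(3:ℝ)/4) := Real.rpow_nonneg (by linarith) _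
  · have h₁ : 1 ≤ z ^ (-(1:ℝ)/4) :=
      Real.one_le_rpow_of_pos_of_le_one_of_nonpos (by linarith) hz₂.le (by norm_num)
    have h₂ : b ^ (-(3:ℝ)/4) ≤ (b - z) ^ (-(3:ℝ)/4) :=
      Real.rpow_le_rpow_of_nonpos (by linarith) (by linarith) (by norm_num)
    have := mul_le_mul_of_nonneg_right (mul_le_mul h₁ h₂ (by positivity) hz₀) (mul_nonneg e₁ e₂)
    linarith
  · have h₁ : z ^ (-(1:ℝ)/4) ≤ (1/2) ^ (-(1:ℝ)/4) :=
      Real.rpow_le_rpow_of_nonpos (by linarith) (by linarith) (by norm_num)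
    have h₂ : (b - z) ^ (-(3:ℝ)/4) ≤ (b - 1) ^ (-(3:ℝ)/4) :=
      Real.rpow_le_rpow_of_nonpos (by linarith) (by linarith) (by norm_num)
    have := mul_le_mul_of_nonneg_right (mul_le_mul h₁ h₂ hb₀ (by positivity)) (mul_nonneg e₁ e₂)
    linarith

lemma Q1_bounds {b : ℝ} (hb : 1 < b) {a : ℝ} (ha : a ∈ Ioo (1 / 2 : ℝ) 1) :
    (1/4 : ℝ) ^ ((1:ℝ)/2) * b ^ (-(1:ℝ)/4) * (1/4) ≤ Q1 a b ∧
      Q1 a b ≤ (b - 1) ^ (-(1:ℝ)/4) * beta (1/4) (3/4) := by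
  obtain ⟨ha₁, ha₂⟩ := ha
  set f : ℝ → ℝ := fun z => z ^ (-(3:ℝ)/4) * (a - z) ^ ((1:ℝ)/2) * (1 - z) ^ (-(3:ℝ)/4) *
    (b - z) ^ (-(1:ℝ)/4) with hf
  have h₀ : ∀ z ∈ Ioo 0 a, 0 ≤ f z := fun z hz =>
    mul_nonneg (mul_nonneg (mul_nonneg (Real.rpow_nonneg hz.1.le _)
      (Real.rpow_nonneg (by linarith [hz.2]) _)) (Real.rpow_nonneg (by linarith [hz.2]) _))
      (Real.rpow_nonneg (by linarith [hz.2]) _)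
  have hsub : Ioo 0 a ⊆ Ioo (0:ℝ) 1 := Ioo_subset_Ioo_right ha₂.le
  have hk := (integrableOn_beta_kernel (α := 1/4) (β := 3/4) (u := 0) (v := 1) (by norm_num)
    (by norm_num) one_pos).const_mul ((b - 1) ^ (-(1:ℝ)/4))
  have hr : ∀ z ∈ Ioo 0 a, f z ≤ (b - 1) ^ (-(1:ℝ)/4) *
      ((z - 0) ^ ((1/4 : ℝ) - 1) * (1 - z) ^ ((3/4 : ℝ) - 1)) := by
    rintro z ⟨hz₁, hz₂⟩
    rw [show (1/4 - 1 : ℝ) = -3/4 by norm_num,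
      show (3/4 - 1 : ℝ) = 1/2 + -3/4 by norm_num, Real.rpow_add (by linarith), sub_zero]
    have h₁ : (a - z) ^ ((1:ℝ)/2) ≤ (1 - z) ^ ((1:ℝ)/2) :=
      Real.rpow_le_rpow (by linarith) (by linarith) (by norm_num)
    have h₂ : (b - z) ^ (-(1:ℝ)/4) ≤ (b - 1) ^ (-(1:ℝ)/4) :=
      Real.rpow_le_rpow_of_nonpos (by linarith) (by linarith) (by norm_num)
    have := mul_le_mul_of_nonneg_right
      (mul_le_mul h₁ h₂ (Real.rpow_nonneg (by linarith) _) (Real.rpow_nonneg (by linarith) _))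
      (mul_nonneg (Real.rpow_nonneg hz₁.le (-(3:ℝ)/4))
        (Real.rpow_nonneg (show 0 ≤ 1 - z by linarith) (-(3:ℝ)/4)))
    simp only [hf]
    linarith
  have hfi := integrableOn_of_nonneg_of_le measurableSet_Ioo (by fun_prop)
    (IntegrableOn.mono_set hk hsub) h₀ hr
  constructor
  · have := const_mul_le_integral_Ioo (u := 0) (w := 1/4) (by norm_num) (by linarith) hfi h₀
      (c := (1/4 : ℝ) ^ ((1:ℝ)/2) * b ^ (-(1:ℝ)/4)) ?_
    · rwa [sub_zero] at this
    rintro z ⟨hz₁, hz₂⟩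
    have h₁ : 1 ≤ z ^ (-(3:ℝ)/4) :=
      Real.one_le_rpow_of_pos_of_le_one_of_nonpos hz₁ (by linarith) (by norm_num)
    have h₂ : (1/4 : ℝ) ^ ((1:ℝ)/2) ≤ (a - z) ^ ((1:ℝ)/2) :=
      Real.rpow_le_rpow (by norm_num) (by linarith) (by norm_num)
    have h₃ : 1 ≤ (1 - z) ^ (-(3:ℝ)/4) :=
      Real.one_le_rpow_of_pos_of_le_one_of_nonpos (by linarith) (by linarith) (by norm_num)
    have h₄ : b ^ (-(1:ℝ)/4) ≤ (b - z) ^ (-(1:ℝ)/4) :=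
      Real.rpow_le_rpow_of_nonpos (by linarith) (by linarith) (by norm_num)
    calc (1/4 : ℝ) ^ ((1:ℝ)/2) * b ^ (-(1:ℝ)/4)
        = 1 * (1/4 : ℝ) ^ ((1:ℝ)/2) * 1 * b ^ (-(1:ℝ)/4) := by ring
      _ ≤ f z := by simp only [hf]; gcongr
  · calc Q1 a b ≤ ∫ z in Ioo 0 a, (b - 1) ^ (-(1:ℝ)/4) *
          ((z - 0) ^ ((1/4 : ℝ) - 1) * (1 - z) ^ ((3/4 : ℝ) - 1)) :=
          setIntegral_mono_on hfi (IntegrableOn.mono_set hk hsub) measurableSet_Ioo hr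
      _ ≤ ∫ z in Ioo 0 1, (b - 1) ^ (-(1:ℝ)/4) *
          ((z - 0) ^ ((1/4 : ℝ) - 1) * (1 - z) ^ ((3/4 : ℝ) - 1)) := by
          refine setIntegral_mono_set hk ((ae_restrict_iff' measurableSet_Ioo).2
            (Filter.Eventually.of_forall fun z hz => ?_)) hsub.eventuallyLE
          exact mul_nonneg (Real.rpow_nonneg (by linarith) _) (mul_nonneg
            (Real.rpow_nonneg (sub_nonneg.2 hz.1.le) _) (Real.rpow_nonneg (sub_nonneg.2 hz.2.le) _))
      _ = (b - 1) ^ (-(1:ℝ)/4) * beta (1/4) (3/4) := by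
          rw [integral_const_mul, integral_beta_kernel (by norm_num) (by norm_num) one_pos]
          norm_num

lemma Q2_bounds {b : ℝ} (hb : 1 < b) {a : ℝ} (ha : a ∈ Ioo (1 / 2 : ℝ) 1) :
    b ^ (-(3:ℝ)/4) * (1/4) ≤ Q2 a b ∧
      Q2 a b ≤ (b - 1) ^ (-(3:ℝ)/4) * beta (3/4) (1/4) := by
  obtain ⟨ha₁, ha₂⟩ := ha
  have ha₀ : 0 < a := by linarith
  set f : ℝ → ℝ := fun z => z ^ (-(1:ℝ)/4) * (a - z) ^ (-(1:ℝ)/2) * (1 - z) ^ (-(1:ℝ)/4) *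
    (b - z) ^ (-(3:ℝ)/4) with hf
  have h₀ : ∀ z ∈ Ioo 0 a, 0 ≤ f z := fun z hz =>
    mul_nonneg (mul_nonneg (mul_nonneg (Real.rpow_nonneg hz.1.le _)
      (Real.rpow_nonneg (by linarith [hz.2]) _)) (Real.rpow_nonneg (by linarith [hz.2]) _))
      (Real.rpow_nonneg (by linarith [hz.2]) _)
  have hk := (integrableOn_beta_kernel (α := 3/4) (β := 1/4) (by norm_num)
    (by norm_num) ha₀).const_mul ((b - 1) ^ (-(3:ℝ)/4))
  have hr : ∀ z ∈ Ioo 0 a, f z ≤ (b - 1) ^ (-(3:ℝ)/4) *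
      ((z - 0) ^ ((3/4 : ℝ) - 1) * (a - z) ^ ((1/4 : ℝ) - 1)) := by
    rintro z ⟨hz₁, hz₂⟩
    rw [show (3/4 - 1 : ℝ) = -1/4 by norm_num,
      show (1/4 - 1 : ℝ) = -1/2 + -1/4 by norm_num, Real.rpow_add (by linarith), sub_zero]
    have h₁ : (1 - z) ^ (-(1:ℝ)/4) ≤ (a - z) ^ (-(1:ℝ)/4) :=
      Real.rpow_le_rpow_of_nonpos (by linarith) (by linarith) (by norm_num)
    have h₂ : (b - z) ^ (-(3:ℝ)/4) ≤ (b - 1) ^ (-(3:ℝ)/4) :=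
      Real.rpow_le_rpow_of_nonpos (by linarith) (by linarith) (by norm_num)
    have := mul_le_mul_of_nonneg_right
      (mul_le_mul h₁ h₂ (Real.rpow_nonneg (by linarith) _) (Real.rpow_nonneg (by linarith) _))
      (mul_nonneg (Real.rpow_nonneg hz₁.le (-(1:ℝ)/4))
        (Real.rpow_nonneg (show 0 ≤ a - z by linarith) (-(1:ℝ)/2)))
    simp only [hf]
    linarith
  have hfi := integrableOn_of_nonneg_of_le measurableSet_Ioo (by fun_prop) hk h₀ hr
  constructor
  · have := const_mul_le_integral_Ioo (u := 0) (w := 1/4) (by norm_num) (by linarith) hfi h₀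
      (c := b ^ (-(3:ℝ)/4)) ?_
    · rwa [sub_zero] at this
    rintro z ⟨hz₁, hz₂⟩
    have h₁ : 1 ≤ z ^ (-(1:ℝ)/4) :=
      Real.one_le_rpow_of_pos_of_le_one_of_nonpos hz₁ (by linarith) (by norm_num)
    have h₂ : 1 ≤ (a - z) ^ (-(1:ℝ)/2) :=
      Real.one_le_rpow_of_pos_of_le_one_of_nonpos (by linarith) (by linarith) (by norm_num)
    have h₃ : 1 ≤ (1 - z) ^ (-(1:ℝ)/4) :=
      Real.one_le_rpow_of_pos_of_le_one_of_nonpos (by linarith) (by linarith) (by norm_num)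
    have h₄ : b ^ (-(3:ℝ)/4) ≤ (b - z) ^ (-(3:ℝ)/4) :=
      Real.rpow_le_rpow_of_nonpos (by linarith) (by linarith) (by norm_num)
    calc b ^ (-(3:ℝ)/4) = 1 * 1 * 1 * b ^ (-(3:ℝ)/4) := by ring
      _ ≤ f z := by simp only [hf]; gcongr
  · calc Q2 a b ≤ ∫ z in Ioo 0 a, (b - 1) ^ (-(3:ℝ)/4) *
          ((z - 0) ^ ((3/4 : ℝ) - 1) * (a - z) ^ ((1/4 : ℝ) - 1)) :=
          setIntegral_mono_on hfi hk measurableSet_Ioo hr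
      _ = (b - 1) ^ (-(3:ℝ)/4) * beta (3/4) (1/4) := by
          rw [integral_const_mul, integral_beta_kernel (by norm_num) (by norm_num) ha₀]
          norm_num

theorem ss4_asymptotics_near_one :
    ∀ b : ℝ, 1 < b → ∃ C δ : ℝ, 0 < C ∧ δ ∈ Ioo (0:ℝ) 1 ∧
      ∀ a ∈ Ioo (1 - δ) 1,
        ((1 / C) * (1 - a) ^ ((3:ℝ)/4) ≤ P1 a b ∧ P1 a b ≤ C * (1 - a) ^ ((3:ℝ)/4)) ∧
        ((1 / C) * (1 - a) ^ ((1:ℝ)/4) ≤ P2 a b ∧ P2 a b ≤ C * (1 - a) ^ ((1:ℝ)/4)) ∧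
        (1 / C ≤ Q1 a b ∧ Q1 a b ≤ C) ∧
        (1 / C ≤ Q2 a b ∧ Q2 a b ≤ C) := by
  intro b hb
  have hb₀ : 0 < b := one_pos.trans hb
  have hX : ∀ p : ℝ, ∀ a ∈ Ioo (1/2 : ℝ) 1, 0 ≤ (1 - a) ^ p := fun p a ha =>
    Real.rpow_nonneg (sub_nonneg.2 ha.2.le) p
  obtain ⟨K₁, hK₁, h₁⟩ := exists_two_sided_const
    (mul_pos (Real.rpow_pos_of_pos hb₀ _) (beta_pos (by norm_num) (by norm_num)))
    (hX (3/4)) fun a ha => P1_bounds hb ha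
  obtain ⟨K₂, hK₂, h₂⟩ := exists_two_sided_const
    (mul_pos (Real.rpow_pos_of_pos hb₀ _) (beta_pos (by norm_num) (by norm_num)))
    (hX (1/4)) fun a ha => P2_bounds hb ha
  obtain ⟨K₃, hK₃, h₃⟩ := exists_two_sided_const (X := fun _ => 1) (s := Ioo (1/2 : ℝ) 1)
    (F := fun a => Q1 a b) (c := (1/4 : ℝ) ^ ((1:ℝ)/2) * b ^ (-(1:ℝ)/4) * (1/4))
    (by positivity) (fun _ _ => zero_le_one)
    (fun a ha => by simpa only [mul_one] using Q1_bounds hb ha)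
  obtain ⟨K₄, hK₄, h₄⟩ := exists_two_sided_const (X := fun _ => 1) (s := Ioo (1/2 : ℝ) 1)
    (F := fun a => Q2 a b) (c := b ^ (-(3:ℝ)/4) * (1/4))
    (by positivity) (fun _ _ => zero_le_one)
    (fun a ha => by simpa only [mul_one] using Q2_bounds hb ha)
  refine ⟨K₁ + K₂ + K₃ + K₄, 1/2, by positivity, by norm_num, fun a ha => ?_⟩
  rw [show (1 - 1/2 : ℝ) = 1/2 by norm_num] at ha
  refine ⟨h₁ _ (by linarith) a ha, h₂ _ (by linarith) a ha, ?_, ?_⟩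
  · simpa only [mul_one] using h₃ (K₁ + K₂ + K₃ + K₄) (by linarith) a ha
  · simpa only [mul_one] using h₄ (K₁ + K₂ + K₃ + K₄) (by linarith) a ha
end

section
/- For each fixed real a < 0 there exists δ ∈ (0,1) such that for all b ∈ (1-δ,1): (B₁(a,b) + C₁(a,b))/A₁(a,b) > (B₂(a,b) + C₂(a,b))/A₂(a,b). (One side of the intermediate-value argument for the CS-4 period problem, near b = 1.) -/
open MeasureTheory Set

/-- A₁(a,b) = ∫_a^0 (z-a)^{1/2}(-z)^{-3/4}(b-z)^{-3/4}(1-z)^{-3/4} dz -/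
noncomputable def A1 (a b : ℝ) : ℝ :=
  ∫ z in Ioo a 0, (z - a) ^ ((1:ℝ)/2) * (-z) ^ (-(3:ℝ)/4) * (b - z) ^ (-(3:ℝ)/4) * (1 - z) ^ (-(3:ℝ)/4)

/-- B₁(a,b) = ∫_{-∞}^a (a-z)^{1/2}(-z)^{-3/4}(b-z)^{-3/4}(1-z)^{-3/4} dz -/
noncomputable def B1 (a b : ℝ) : ℝ :=
  ∫ z in Iio a, (a - z) ^ ((1:ℝ)/2) * (-z) ^ (-(3:ℝ)/4) * (b - z) ^ (-(3:ℝ)/4) * (1 - z) ^ (-(3:ℝ)/4)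

/-- C₁(a,b) = ∫_b^1 (z-a)^{1/2} z^{-3/4}(z-b)^{-3/4}(1-z)^{-3/4} dz -/
noncomputable def C1 (a b : ℝ) : ℝ :=
  ∫ z in Ioo b 1, (z - a) ^ ((1:ℝ)/2) * z ^ (-(3:ℝ)/4) * (z - b) ^ (-(3:ℝ)/4) * (1 - z) ^ (-(3:ℝ)/4)

/-- A₂(a,b) = ∫_a^0 (z-a)^{-1/2}(-z)^{-1/4}(b-z)^{-1/4}(1-z)^{-1/4} dz -/
noncomputable def A2 (a b : ℝ) : ℝ :=
  ∫ z in Ioo a 0, (z - a) ^ (-(1:ℝ)/2) * (-z) ^ (-(1:ℝ)/4) * (b - z) ^ (-(1:ℝ)/4) * (1 - z) ^ (-(1:ℝ)/4)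

/-- B₂(a,b) = ∫_{-∞}^a (a-z)^{-1/2}(-z)^{-1/4}(b-z)^{-1/4}(1-z)^{-1/4} dz -/
noncomputable def B2 (a b : ℝ) : ℝ :=
  ∫ z in Iio a, (a - z) ^ (-(1:ℝ)/2) * (-z) ^ (-(1:ℝ)/4) * (b - z) ^ (-(1:ℝ)/4) * (1 - z) ^ (-(1:ℝ)/4)

/-- C₂(a,b) = ∫_b^1 (z-a)^{-1/2} z^{-1/4}(z-b)^{-1/4}(1-z)^{-1/4} dz -/
noncomputable def C2 (a b : ℝ) : ℝ :=
  ∫ z in Ioo b 1, (z - a) ^ (-(1:ℝ)/2) * z ^ (-(1:ℝ)/4) * (z - b) ^ (-(1:ℝ)/4) * (1 - z) ^ (-(1:ℝ)/4)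

theorem integrableOn_Ioo_rpow_mul_rpow {a b p q : ℝ} (hab : a < b) (hp : -1 < p) (hq : -1 < q) :
    IntegrableOn (fun z : ℝ => (z - a) ^ p * (b - z) ^ q) (Ioo a b) := by
  have hac : a ≤ (a + b) / 2 := by linarith
  have hcb : (a + b) / 2 ≤ b := by linarith
  have left : IntervalIntegrable (fun z : ℝ => (z - a) ^ p * (b - z) ^ q) volume a ((a + b) / 2) := by
    refine IntervalIntegrable.mul_continuousOn ?_ ?_
    · simpa using (intervalIntegral.intervalIntegrable_rpow' (a := 0) (b := (a + b) / 2 - a)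
        hp).comp_sub_right a
    · rw [uIcc_of_le hac]
      refine ContinuousOn.rpow_const (by fun_prop) fun z hz => Or.inl ?_
      linarith [hz.2]
  have right : IntervalIntegrable (fun z : ℝ => (z - a) ^ p * (b - z) ^ q) volume ((a + b) / 2) b := by
    refine IntervalIntegrable.continuousOn_mul ?_ ?_
    · simpa using (intervalIntegral.intervalIntegrable_rpow' (a := b - (a + b) / 2) (b := 0)
        hq).comp_sub_left b
    · rw [uIcc_of_le hcb]
      refine ContinuousOn.rpow_const (by fun_prop) fun z hz => Or.inl ?_
      linarith [hz.1]
  exact (intervalIntegrable_iff_integrableOn_Ioo_of_le hab.le).1 (left.trans right)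

theorem integrableOn_Ioo_rpow_mul_rpow_mul {a b p q : ℝ} {g : ℝ → ℝ} (hab : a < b) (hp : -1 < p)
    (hq : -1 < q) (hg : ContinuousOn g (Icc a b)) :
    IntegrableOn (fun z : ℝ => (z - a) ^ p * (b - z) ^ q * g z) (Ioo a b) := by
  have h := (intervalIntegrable_iff_integrableOn_Ioo_of_le hab.le).2
    (integrableOn_Ioo_rpow_mul_rpow hab hp hq)
  refine (intervalIntegrable_iff_integrableOn_Ioo_of_le hab.le).1 (h.mul_continuousOn ?_)
  rwa [uIcc_of_le hab.le]

theorem integrableOn_Ioo_four_rpow {a b p q r : ℝ} (ha : a < 0) (hb : 0 < b) (hp : -1 < p)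
    (hq : -1 < q) :
    IntegrableOn (fun z : ℝ => (z - a) ^ p * (-z) ^ q * (b - z) ^ r * (1 - z) ^ r) (Ioo a 0) := by
  have h := integrableOn_Ioo_rpow_mul_rpow_mul (g := fun z => (b - z) ^ r * (1 - z) ^ r) ha hp hq
    (ContinuousOn.mul
      (ContinuousOn.rpow_const (by fun_prop) fun z hz => Or.inl (by linarith [hz.2]))
      (ContinuousOn.rpow_const (by fun_prop) fun z hz => Or.inl (by linarith [hz.2])))
  simpa only [zero_sub, mul_assoc] using h

theorem setIntegral_Ioo_pos {a b : ℝ} {f : ℝ → ℝ} (hab : a < b) (hf : IntegrableOn f (Ioo a b))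
    (hpos : ∀ z ∈ Ioo a b, 0 < f z) : 0 < ∫ z in Ioo a b, f z := by
  rw [← integral_Ioc_eq_integral_Ioo, ← intervalIntegral.integral_of_le hab.le]
  exact intervalIntegral.intervalIntegral_pos_of_pos_on
    ((intervalIntegrable_iff_integrableOn_Ioo_of_le hab.le).2 hf) hpos hab

theorem setIntegral_mono_of_nonneg_on {s : Set ℝ} {f g : ℝ → ℝ} (hs : MeasurableSet s)
    (hf : ∀ z ∈ s, 0 ≤ f z) (hg : IntegrableOn g s) (hfg : ∀ z ∈ s, f z ≤ g z) :
    ∫ z in s, f z ≤ ∫ z in s, g z :=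
  integral_mono_of_nonneg (ae_restrict_of_forall_mem hs hf) hg (ae_restrict_of_forall_mem hs hfg)

theorem integrableOn_Ioi_rpow_mul_rpow {c p q : ℝ} (hc : 0 < c) (hp : -1 < p) (hq : q ≤ 0)
    (hpq : p + q < -1) : IntegrableOn (fun t : ℝ => t ^ p * (t + c) ^ q) (Ioi 0) := by
  rw [← Ioc_union_Ioi_eq_Ioi (zero_le_one (α := ℝ))]
  refine IntegrableOn.union ?_ ?_
  · rw [← intervalIntegrable_iff_integrableOn_Ioc_of_le zero_le_one]
    refine (intervalIntegral.intervalIntegrable_rpow' hp).mul_continuousOn ?_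
    rw [uIcc_of_le zero_le_one]
    exact ContinuousOn.rpow_const (by fun_prop) fun z hz => Or.inl (by linarith [hz.1])
  · refine Integrable.mono' (integrableOn_Ioi_rpow_of_lt hpq zero_lt_one)
      (by fun_prop) (ae_restrict_of_forall_mem measurableSet_Ioi fun t ht => ?_)
    have ht' : (0 : ℝ) < t := zero_lt_one.trans ht
    rw [Real.norm_of_nonneg (by positivity), Real.rpow_add ht']
    gcongr ?_ * ?_
    exact Real.rpow_le_rpow_of_nonpos ht' (by linarith) hq

theorem integrableOn_Iio_rpow_mul_rpow {a p q : ℝ} (ha : a < 0) (hp : -1 < p) (hq : q ≤ 0)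
    (hpq : p + q < -1) : IntegrableOn (fun z : ℝ => (a - z) ^ p * (-z) ^ q) (Iio a) := by
  have h := ((Measure.measurePreserving_sub_left volume a).integrableOn_comp_preimage
    (MeasurableEquiv.subLeft a).measurableEmbedding).2
    (integrableOn_Ioi_rpow_mul_rpow (neg_pos.2 ha) hp hq hpq)
  have hs : (fun z : ℝ => a - z) ⁻¹' Ioi 0 = Iio a := by ext; simp
  rw [hs] at h
  refine h.congr_fun (fun z _ => ?_) measurableSet_Iio
  simp only [Function.comp]
  congr 2
  ring

theorem A1_pos {a b : ℝ} (ha : a < 0) (hb : 0 < b) : 0 < A1 a b := by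
  refine setIntegral_Ioo_pos ha
    (integrableOn_Ioo_four_rpow ha hb (by norm_num) (by norm_num)) fun z ⟨h1, h2⟩ => ?_
  have := sub_pos.2 h1
  have := neg_pos.2 h2
  have : 0 < b - z := by linarith
  have : 0 < 1 - z := by linarith
  positivity

theorem A2_pos {a b : ℝ} (ha : a < 0) (hb : 0 < b) : 0 < A2 a b := by
  refine setIntegral_Ioo_pos ha
    (integrableOn_Ioo_four_rpow ha hb (by norm_num) (by norm_num)) fun z ⟨h1, h2⟩ => ?_
  have := sub_pos.2 h1
  have := neg_pos.2 h2
  have : 0 < b - z := by linarith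
  have : 0 < 1 - z := by linarith
  positivity

theorem A1_antitoneOn {a : ℝ} (ha : a < 0) : AntitoneOn (A1 a) (Ioi 0) := by
  intro b (hb : 0 < b) c (hc : 0 < c) hbc
  refine setIntegral_mono_on
    (integrableOn_Ioo_four_rpow ha hc (by norm_num) (by norm_num))
    (integrableOn_Ioo_four_rpow ha hb (by norm_num) (by norm_num))
    measurableSet_Ioo fun z ⟨h1, h2⟩ => ?_
  have := sub_pos.2 h1
  have := neg_pos.2 h2
  have : 0 < b - z := by linarith
  have : 0 < 1 - z := by linarith
  gcongr ?_ * ?_ * ?_ * ?_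
  exact Real.rpow_le_rpow_of_nonpos ‹0 < b - z› (by linarith) (by norm_num)

theorem A2_antitoneOn {a : ℝ} (ha : a < 0) : AntitoneOn (A2 a) (Ioi 0) := by
  intro b (hb : 0 < b) c (hc : 0 < c) hbc
  refine setIntegral_mono_on
    (integrableOn_Ioo_four_rpow ha hc (by norm_num) (by norm_num))
    (integrableOn_Ioo_four_rpow ha hb (by norm_num) (by norm_num))
    measurableSet_Ioo fun z ⟨h1, h2⟩ => ?_
  have := sub_pos.2 h1
  have := neg_pos.2 h2
  have : 0 < b - z := by linarith
  have : 0 < 1 - z := by linarith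
  gcongr ?_ * ?_ * ?_ * ?_
  exact Real.rpow_le_rpow_of_nonpos ‹0 < b - z› (by linarith) (by norm_num)

theorem B1_nonneg {a b : ℝ} (ha : a < 0) (hb : 0 < b) : 0 ≤ B1 a b := by
  refine setIntegral_nonneg measurableSet_Iio fun z (hz : z < a) => ?_
  have := sub_pos.2 hz
  have : 0 < -z := by linarith
  have : 0 < b - z := by linarith
  have : 0 < 1 - z := by linarith
  positivity

theorem B2_le {a b : ℝ} (ha : a < 0) (hb : 0 < b) :
    B2 a b ≤ ∫ z in Iio a, (a - z) ^ (-(1 : ℝ) / 2) * (-z) ^ (-(3 : ℝ) / 4) := by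
  refine setIntegral_mono_of_nonneg_on measurableSet_Iio (fun z (hz : z < a) => ?_)
    (integrableOn_Iio_rpow_mul_rpow ha (by norm_num) (by norm_num) (by norm_num))
    fun z (hz : z < a) => ?_
  all_goals
    have := sub_pos.2 hz
    have hz0 : 0 < -z := by linarith
    have : 0 < b - z := by linarith
    have : 0 < 1 - z := by linarith
  · positivity
  · have hsplit : (-z) ^ (-(3 : ℝ) / 4)
        = (-z) ^ (-(1 : ℝ) / 4) * (-z) ^ (-(1 : ℝ) / 4) * (-z) ^ (-(1 : ℝ) / 4) := by
      rw [← Real.rpow_add hz0, ← Real.rpow_add hz0]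
      norm_num
    rw [hsplit, ← mul_assoc, ← mul_assoc]
    gcongr ?_ * ?_ * ?_ * ?_
    · exact Real.rpow_le_rpow_of_nonpos hz0 (by linarith) (by norm_num)
    · exact Real.rpow_le_rpow_of_nonpos hz0 (by linarith) (by norm_num)

theorem integrableOn_C1 {a b : ℝ} (ha : a < 0) (hb : 0 < b) (hb1 : b < 1) :
    IntegrableOn (fun z : ℝ => (z - a) ^ ((1 : ℝ) / 2) * z ^ (-(3 : ℝ) / 4)
      * (z - b) ^ (-(3 : ℝ) / 4) * (1 - z) ^ (-(3 : ℝ) / 4)) (Ioo b 1) := by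
  refine (integrableOn_Ioo_rpow_mul_rpow_mul (p := -(3 : ℝ) / 4) (q := -(3 : ℝ) / 4)
    (g := fun z => (z - a) ^ ((1 : ℝ) / 2) * z ^ (-(3 : ℝ) / 4)) hb1 (by norm_num) (by norm_num)
    (ContinuousOn.mul
      (ContinuousOn.rpow_const (by fun_prop) fun z hz => Or.inl (by linarith [hz.1]))
      (ContinuousOn.rpow_const (by fun_prop) fun z hz => Or.inl (by linarith [hz.1])))).congr_fun
    (fun z _ => ?_) measurableSet_Ioo
  ring

theorem le_C1 {a b : ℝ} (ha : a < 0) (hb : 0 < b) (hb1 : b < 1) :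
    (-a) ^ ((1 : ℝ) / 2) * (1 - b) ^ (-(1 : ℝ) / 2) ≤ C1 a b := by
  have h1b : 0 < 1 - b := sub_pos.2 hb1
  have ha' := neg_pos.2 ha
  have hconst : (-a) ^ ((1 : ℝ) / 2) * (1 - b) ^ (-(1 : ℝ) / 2) = ∫ _ in Ioo b 1,
      (-a) ^ ((1 : ℝ) / 2) * 1 * (1 - b) ^ (-(3 : ℝ) / 4) * (1 - b) ^ (-(3 : ℝ) / 4) := by
    have hpow : (1 - b) ^ (-(1 : ℝ) / 2)
        = (1 - b) * ((1 - b) ^ (-(3 : ℝ) / 4) * (1 - b) ^ (-(3 : ℝ) / 4)) := by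
      rw [← Real.rpow_add h1b, ← Real.rpow_one_add' h1b.le (by norm_num)]
      norm_num
    rw [setIntegral_const, Real.volume_real_Ioo_of_le hb1.le, hpow, smul_eq_mul]
    ring
  rw [hconst]
  refine setIntegral_mono_on (integrableOn_const (by simp))
    (integrableOn_C1 ha hb hb1) measurableSet_Ioo fun z ⟨h1, h2⟩ => ?_
  have : 0 < z := hb.trans h1
  have : 0 < z - b := sub_pos.2 h1
  have : 0 < 1 - z := sub_pos.2 h2
  have : 0 < z - a := by linarith
  gcongr ?_ * ?_ * ?_ * ?_
  · exact Real.rpow_le_rpow ha'.le (by linarith) (by norm_num)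
  · exact Real.one_le_rpow_of_pos_of_le_one_of_nonpos (hb.trans h1) h2.le (by norm_num)
  · exact Real.rpow_le_rpow_of_nonpos (sub_pos.2 h1) (by linarith) (by norm_num)
  · exact Real.rpow_le_rpow_of_nonpos (sub_pos.2 h2) (by linarith) (by norm_num)

theorem C2_le {a b : ℝ} (ha : a < 0) (hb : 0 < b) (hb1 : b < 1) :
    C2 a b ≤ (1 - b) / (-a) * C1 a b := by
  unfold C1 C2
  rw [← integral_const_mul]
  refine setIntegral_mono_of_nonneg_on measurableSet_Ioo (fun z ⟨h1, h2⟩ => ?_)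
    ((integrableOn_C1 ha hb hb1).const_mul _) fun z ⟨h1, h2⟩ => ?_
  all_goals
    have hz : 0 < z := hb.trans h1
    have hzb : 0 < z - b := sub_pos.2 h1
    have hz1 : 0 < 1 - z := sub_pos.2 h2
    have hza : 0 < z - a := by linarith
  · positivity
  · have h1b : 0 < 1 - b := sub_pos.2 hb1
    have ha' := neg_pos.2 ha
    have quarter : ∀ {x : ℝ}, 0 < x →
        x ^ (-(1 : ℝ) / 4) = x ^ ((1 : ℝ) / 2) * x ^ (-(3 : ℝ) / 4) := fun hx => by
      rw [← Real.rpow_add hx]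
      norm_num
    have half : (z - a) ^ (-(1 : ℝ) / 2) = (z - a)⁻¹ * (z - a) ^ ((1 : ℝ) / 2) := by
      rw [← Real.rpow_neg_one, ← Real.rpow_add hza]
      norm_num
    have sq : (1 - b) ^ ((1 : ℝ) / 2) * (1 - b) ^ ((1 : ℝ) / 2) = 1 - b := by
      rw [← Real.rpow_add h1b]
      norm_num
    have key : (z - a)⁻¹ * (z ^ ((1 : ℝ) / 2) * ((z - b) ^ ((1 : ℝ) / 2) *
        (1 - z) ^ ((1 : ℝ) / 2))) ≤ (-a)⁻¹ * (1 * ((1 - b) ^ ((1 : ℝ) / 2) *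
        (1 - b) ^ ((1 : ℝ) / 2))) := by
      gcongr
      · linarith
      · exact Real.rpow_le_one hz.le h2.le (by norm_num)
    rw [sq, one_mul] at key
    rw [quarter hz, quarter hzb, quarter hz1, half]
    have hC1 : 0 ≤ (z - a) ^ ((1 : ℝ) / 2) * z ^ (-(3 : ℝ) / 4) * (z - b) ^ (-(3 : ℝ) / 4)
        * (1 - z) ^ (-(3 : ℝ) / 4) := by positivity
    refine le_trans (le_of_eq ?_)
      (mul_le_mul_of_nonneg_right (key.trans_eq (inv_mul_eq_div _ _)) hC1)
    ring


theorem cs4_ratio_comparison_near_one :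
    ∀ a : ℝ, a < 0 → ∃ δ : ℝ, δ ∈ Ioo (0:ℝ) 1 ∧
      ∀ b ∈ Ioo (1 - δ) 1,
        (B1 a b + C1 a b) / A1 a b > (B2 a b + C2 a b) / A2 a b := by
  intro a ha
  have ha' : 0 < -a := neg_pos.2 ha
  set N := A1 a (1 / 2) with hN
  set c := A2 a 1 with hc
  set M := ∫ z in Iio a, (a - z) ^ (-(1 : ℝ) / 2) * (-z) ^ (-(3 : ℝ) / 4) with hM
  have hNpos : 0 < N := A1_pos ha (by norm_num)
  have hcpos : 0 < c := A2_pos ha one_pos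
  have hMnonneg : 0 ≤ M := by
    refine setIntegral_nonneg measurableSet_Iio fun z (hz : z < a) => ?_
    have := sub_pos.2 hz
    have : 0 < -z := by linarith
    positivity
  have hblow : ∀ᶠ t in nhdsWithin (0 : ℝ) (Ioi 0),
      2 * N * M / c < (-a) ^ ((1 : ℝ) / 2) * t ^ (-(1 : ℝ) / 2) :=
    ((tendsto_rpow_neg_nhdsGT_zero (by norm_num)).const_mul_atTop
      (by positivity)).eventually_gt_atTop _
  have hsmall : ∀ᶠ t in nhdsWithin (0 : ℝ) (Ioi 0), t < c * (-a) / (2 * N) ∧ t < 1 / 2 :=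
    nhdsWithin_le_nhds ((eventually_lt_nhds (by positivity)).and
      (eventually_lt_nhds (by norm_num)))
  obtain ⟨ε, hε, hε'⟩ := mem_nhdsGT_iff_exists_Ioo_subset.1 (hblow.and hsmall)
  refine ⟨min ε (1 / 2), ⟨lt_min hε (by norm_num), by
    exact (min_le_right _ _).trans_lt (by norm_num)⟩, fun b ⟨hb, hb1⟩ => ?_⟩
  obtain ⟨hlarge, hlt, hhalf⟩ := hε' (show 1 - b ∈ Ioo 0 ε from
    ⟨by linarith, by linarith [min_le_left ε (1 / 2)]⟩)
  have hb0 : 0 < b := by linarith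
  have hA1 : A1 a b ≤ N :=
    A1_antitoneOn ha (show (0 : ℝ) < 1 / 2 by norm_num) hb0 (by linarith)
  have hA2 : c ≤ A2 a b := A2_antitoneOn ha hb0 (mem_Ioi.2 one_pos) hb1.le
  have hC1 : 2 * N * M / c < C1 a b := hlarge.trans_le (le_C1 ha hb0 hb1)
  have hC1pos : 0 < C1 a b := lt_of_le_of_lt (by positivity) hC1
  calc (B2 a b + C2 a b) / A2 a b
      ≤ (M + (1 - b) / (-a) * C1 a b) / A2 a b := by
        have := A2_pos ha hb0
        gcongr
        · exact B2_le ha hb0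
        · exact C2_le ha hb0 hb1
    _ ≤ (M + (1 - b) / (-a) * C1 a b) / c := by
        have : 0 < 1 - b := sub_pos.2 hb1
        gcongr
    _ < C1 a b / N := by
        have h1 : M < C1 a b * c / (2 * N) := by
          rw [div_lt_iff₀ hcpos] at hC1
          rw [lt_div_iff₀ (by positivity)]
          linarith
        have h2 : (1 - b) / (-a) * C1 a b < c / (2 * N) * C1 a b := by
          refine mul_lt_mul_of_pos_right ?_ hC1pos
          rw [div_lt_iff₀ ha']
          exact hlt.trans_eq (by ring)
        rw [div_lt_iff₀ hcpos]
        calc M + (1 - b) / (-a) * C1 a b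
            < C1 a b * c / (2 * N) + c / (2 * N) * C1 a b := add_lt_add h1 h2
          _ = C1 a b / N * c := by
            field_simp
            ring
    _ ≤ (B1 a b + C1 a b) / A1 a b := by
        have := A1_pos ha hb0
        have := B1_nonneg ha hb0
        gcongr
        linarith
end
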